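/- Let 1 ≤ p ≤ 2, 0 < q < ∞ and 0 ≤ 1/q − 1/p′ ≤ β < ∞, where 1/p′ = 1 − 1/p. Then there is a constant C > 0 (depending only on p, q, β) such that for every f ∈ L^p(ℝ) one has sup_{t>0} t · |{ξ ∈ ℝ : (1+|ξ|)^{−β}·|f̂(ξ)| > t}|^{1/q} ≤ C · ‖f‖_{L^p(ℝ)}, where f̂ denotes the Fourier transform of f on ℝ and | · | is Lebesgue measure. -/

import Mathlib

open MeasureTheory Real Set
open scoped ENNReal FourierTransform

/-- On `L¹ ∩ L²` the integral Fourier transform agrees a.e. with the `L²` one. -/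
lemma fourier_ae_eq_L2 (g : ℝ → ℂ) (hg1 : Integrable g volume) (hg2 : MemLp g 2 volume) :
    ∀ᵐ x ∂(volume : Measure ℝ), 𝓕 g x = (𝓕 (hg2.toLp g) : Lp (α := ℝ) ℂ 2 volume) x := by
  have hcont : Continuous (𝓕 g) :=
    VectorFourier.fourierIntegral_continuous (L := innerₗ ℝ) Real.continuous_fourierChar
      continuous_inner hg1
  apply ae_eq_of_integral_contDiff_smul_eq
  · exact hcont.locallyIntegrable
  · exact (Lp.memLp _).locallyIntegrable (by norm_num)
  · intro φ φ_smooth φ_cpt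
    have h1 : HasCompactSupport (Complex.ofRealCLM ∘ φ) := φ_cpt.comp_left rfl
    have h2 : ContDiff ℝ ((⊤ : ℕ∞) : WithTop ℕ∞) (Complex.ofRealCLM ∘ φ) := by fun_prop
    set ψ : SchwartzMap ℝ ℂ := h1.toSchwartzMap h2 with hψ
    have hval : ∀ x, ψ x = (φ x : ℂ) := fun x => by simp [hψ]
    have e1 : ∫ x, φ x • (𝓕 (hg2.toLp g) : Lp (α := ℝ) ℂ 2 volume) x
        = ((𝓕 (hg2.toLp g) : Lp (α := ℝ) ℂ 2 volume) : TemperedDistribution ℝ ℂ) ψ := by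
      rw [Lp.toTemperedDistribution_apply]
      simp [hval]
    rw [e1, ← Lp.fourier_toTemperedDistribution_eq, TemperedDistribution.fourier_apply,
      Lp.toTemperedDistribution_apply]
    have e2 : ∫ x, (𝓕 ψ) x • (hg2.toLp g) x = ∫ x, (𝓕 ψ) x • g x := by
      apply integral_congr_ae
      filter_upwards [hg2.coeFn_toLp] with x hx
      rw [hx]
    rw [e2]
    have e3 := VectorFourier.integral_bilin_fourierIntegral_eq_flip
      (ContinuousLinearMap.lsmul ℂ ℂ (E := ℂ)) (L := innerₗ ℝ) (μ := volume) (ν := volume)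
      Real.continuous_fourierChar continuous_inner ψ.integrable hg1
    have e4 : ∫ x, φ x • 𝓕 g x = ∫ x, ψ x • 𝓕 g x := by simp [hval]
    rw [e4]
    simpa using! e3.symm

lemma plancherel_weak (g : ℝ → ℂ) (hg1 : Integrable g volume) (hg2 : MemLp g 2 volume)
    (l : ℝ) (hl : 0 < l) :
    volume {ξ : ℝ | l ≤ ‖𝓕 g ξ‖} ≤ ENNReal.ofReal ((∫ x, ‖g x‖ ^ 2) / l ^ 2) := by
  have hae := fourier_ae_eq_L2 g hg1 hg2
  set F : Lp (α := ℝ) ℂ 2 volume := 𝓕 (hg2.toLp g) with hF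
  have hmeas : AEStronglyMeasurable (𝓕 g) volume :=
    (Lp.aestronglyMeasurable F).congr (by filter_upwards [hae] with x hx using hx.symm)
  have hnorm : eLpNorm (𝓕 g) 2 volume = eLpNorm g 2 volume := by
    rw [eLpNorm_congr_ae hae]
    have : ‖F‖ₑ = ‖hg2.toLp g‖ₑ := by
      rw [← ofReal_norm, ← ofReal_norm, hF, Lp.norm_fourier_eq]
    rwa [Lp.enorm_def, Lp.enorm_toLp] at this
  have h := mul_meas_ge_le_pow_eLpNorm' volume (p := 2) two_ne_zero ENNReal.ofNat_ne_top hmeas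
    (ENNReal.ofReal l)
  rw [hnorm] at h
  have hI : eLpNorm g 2 volume ^ (2 : ℝ≥0∞).toReal = ENNReal.ofReal (∫ x, ‖g x‖ ^ 2) := by
    rw [hg2.eLpNorm_eq_integral_rpow_norm two_ne_zero ENNReal.ofNat_ne_top]
    have h0 : 0 ≤ ∫ x, ‖g x‖ ^ 2 := integral_nonneg fun x => by positivity
    simp only [ENNReal.toReal_ofNat, Real.rpow_ofNat]
    rw [ENNReal.ofReal_rpow_of_nonneg (by positivity) (by norm_num),
      ← Real.rpow_mul h0]
    norm_num
  rw [hI] at h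
  have hset : {x | ENNReal.ofReal l ≤ ‖𝓕 g x‖ₑ} = {ξ : ℝ | l ≤ ‖𝓕 g ξ‖} := by
    ext x
    simp only [mem_ofPred_eq, ← ofReal_norm]
    exact ENNReal.ofReal_le_ofReal_iff (norm_nonneg _)
  rw [hset, ENNReal.ofReal_rpow_of_pos hl] at h
  have hl2 : 0 < l ^ (2 : ℝ≥0∞).toReal := by positivity
  rw [ENNReal.ofReal_div_of_pos (by positivity)]
  rw [ENNReal.le_div_iff_mul_le (Or.inl (by simpa using hl.ne')) (Or.inl ENNReal.ofReal_ne_top), mul_comm]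
  simpa using h

/-- Weak Hausdorff-Young inequality. -/
lemma weak_hausdorff_young (p : ℝ) (hp1 : 1 ≤ p) (hp2 : p ≤ 2) (f : ℝ → ℂ) (hfm : StronglyMeasurable f)
    (hf1 : Integrable f volume) (hfp : Integrable (fun x => ‖f x‖ ^ p) volume)
    (A : ℝ) (hA : 0 < A) (hI : ∫ x, ‖f x‖ ^ p = A ^ p) (R : ℝ) (hR : 0 < R) :
    volume {ξ : ℝ | 2 * (R ^ (1 / p - 1) * A) < ‖𝓕 f ξ‖} ≤ ENNReal.ofReal R := by
  have hp0 : 0 < p := by linarith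
  set h : ℝ := R ^ (1 / p) * A with hh
  have hh0 : 0 < h := by positivity
  set l : ℝ := R ^ (1 / p - 1) * A with hl
  have hl0 : 0 < l := by positivity
  set S : Set ℝ := {x | h < ‖f x‖} with hS
  have hSm : MeasurableSet S := measurableSet_lt measurable_const hfm.norm.measurable
  set f1 := S.indicator f with hf1d
  set f2 := Sᶜ.indicator f with hf2d
  have i1 : Integrable f1 volume := hf1.indicator hSm
  have i2 : Integrable f2 volume := hf1.indicator hSm.compl
  have hsum : f = f1 + f2 := (Set.indicator_self_add_compl S f).symm
  have hF : ∀ ξ, 𝓕 f ξ = 𝓕 f1 ξ + 𝓕 f2 ξ := by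
    intro ξ
    conv_lhs => rw [hsum]
    exact congrFun (VectorFourier.fourierIntegral_add (L := innerₗ ℝ) Real.continuous_fourierChar
      continuous_inner i1 i2).symm ξ |>.symm
  have b1 : ∀ x, ‖f1 x‖ ≤ h ^ (1 - p) * ‖f x‖ ^ p := by
    intro x
    by_cases hx : x ∈ S
    · have hx' : h < ‖f x‖ := hx
      have hpos : 0 < ‖f x‖ := hh0.trans hx'
      rw [hf1d, Set.indicator_of_mem hx]
      calc ‖f x‖ = ‖f x‖ ^ (1 - p) * ‖f x‖ ^ p := by
            rw [← Real.rpow_add hpos]; simp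
        _ ≤ _ := by
            apply mul_le_mul_of_nonneg_right _ (by positivity)
            exact Real.rpow_le_rpow_of_nonpos hh0 hx'.le (by linarith)
    · rw [hf1d, Set.indicator_of_notMem hx, norm_zero]; positivity
  have b2 : ∀ x, ‖f2 x‖ ^ 2 ≤ h ^ (2 - p) * ‖f x‖ ^ p := by
    intro x
    by_cases hx : x ∈ S
    · have : f2 x = 0 := Set.indicator_of_notMem (by simpa using hx) f
      rw [this, norm_zero]
      simp only [ne_eq, OfNat.ofNat_ne_zero, not_false_eq_true, zero_pow]; positivity
    · have hx' : ‖f x‖ ≤ h := not_lt.mp hx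
      have : f2 x = f x := Set.indicator_of_mem hx f
      rw [this]
      rcases (norm_nonneg (f x)).eq_or_lt with h0 | hpos
      · rw [← h0]; simp only [ne_eq, OfNat.ofNat_ne_zero, not_false_eq_true, zero_pow]; positivity
      calc ‖f x‖ ^ 2 = ‖f x‖ ^ (2 - p) * ‖f x‖ ^ p := by
            rw [← Real.rpow_add hpos]; simp
        _ ≤ _ := by
            apply mul_le_mul_of_nonneg_right _ (by positivity)
            exact Real.rpow_le_rpow hpos.le hx' (by linarith)
  have i22 : Integrable (fun x => ‖f2 x‖ ^ 2) volume := by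
    apply (hfp.const_mul (h ^ (2 - p))).mono'
    · exact (i2.1.norm.pow 2)
    · filter_upwards with x
      rw [Real.norm_of_nonneg (by positivity)]
      exact b2 x
  have m2 : MemLp f2 2 volume := (memLp_two_iff_integrable_sq_norm i2.1).2 i22
  have I1 : ∫ x, ‖f1 x‖ ≤ l := by
    calc ∫ x, ‖f1 x‖ ≤ ∫ x, h ^ (1 - p) * ‖f x‖ ^ p :=
          integral_mono i1.norm (hfp.const_mul _) b1
      _ = h ^ (1 - p) * A ^ p := by rw [integral_const_mul, hI]
      _ = l := by
          rw [hh, hl, Real.mul_rpow (by positivity) hA.le, ← Real.rpow_mul hR.le, mul_assoc,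
            ← Real.rpow_add hA]
          congr 1
          · congr 1; field_simp
          · simp
  have I2 : ∫ x, ‖f2 x‖ ^ 2 ≤ R * l ^ 2 := by
    calc ∫ x, ‖f2 x‖ ^ 2 ≤ ∫ x, h ^ (2 - p) * ‖f x‖ ^ p :=
          integral_mono i22 (hfp.const_mul _) b2
      _ = h ^ (2 - p) * A ^ p := by rw [integral_const_mul, hI]
      _ = R * l ^ 2 := by
          rw [hh, hl, Real.mul_rpow (by positivity) hA.le, ← Real.rpow_mul hR.le, mul_assoc,
            ← Real.rpow_add hA, mul_pow, ← mul_assoc, ← Real.rpow_natCast (R ^ (1 / p - 1)),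
            ← Real.rpow_mul hR.le]
          nth_rewrite 2 [← Real.rpow_one R]
          rw [← Real.rpow_add hR]
          congr 1
          · congr 1; push_cast; field_simp; ring
          · simp
  calc volume {ξ : ℝ | 2 * l < ‖𝓕 f ξ‖} ≤ volume {ξ : ℝ | l ≤ ‖𝓕 f2 ξ‖} := by
        apply measure_mono
        intro ξ hξ
        simp only [mem_ofPred_eq] at hξ ⊢
        rw [hF] at hξ
        have n1 : ‖𝓕 f1 ξ‖ ≤ l :=
          (VectorFourier.norm_fourierIntegral_le_integral_norm _ _ (innerₗ ℝ) f1 ξ).trans I1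
        have := norm_add_le (𝓕 f1 ξ) (𝓕 f2 ξ)
        linarith
    _ ≤ ENNReal.ofReal ((∫ x, ‖f2 x‖ ^ 2) / l ^ 2) := plancherel_weak f2 i2 m2 l hl0
    _ ≤ ENNReal.ofReal R := by
        apply ENNReal.ofReal_le_ofReal
        rw [div_le_iff₀ (by positivity)]
        exact I2

/-- Proposition 7 (Pitt-type weak estimate): for `1 ≤ p ≤ 2`, `0 < q < ∞` and
`0 ≤ 1/q - 1/p' ≤ β`, one has `‖(1+|·|)^{-β} 𝓕 f‖_{L^{q,∞}(ℝ)} ≲ ‖f‖_{L^p(ℝ)}`. -/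
theorem statement4 (p q β : ℝ) (hp1 : 1 ≤ p) (hp2 : p ≤ 2) (hq : 0 < q)
    (hβ1 : 0 ≤ 1 / q - (1 - 1 / p)) (hβ2 : 1 / q - (1 - 1 / p) ≤ β) :
    ∃ C : ℝ, 0 < C ∧ ∀ f : ℝ → ℂ, MemLp f (ENNReal.ofReal p) volume →
      ∀ t : ℝ, 0 < t →
        ENNReal.ofReal t *
            (volume {ξ : ℝ | t < (1 + |ξ|) ^ (-β) * ‖𝓕 f ξ‖}) ^ (1 / q) ≤
          ENNReal.ofReal C * eLpNorm f (ENNReal.ofReal p) volume := by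
  have hp0 : 0 < p := by linarith
  refine ⟨3 ^ (1 / q) * 2, by positivity, ?_⟩
  intro f hf t ht
  have hempty : (∀ ξ, 𝓕 f ξ = 0) → ENNReal.ofReal t *
            (volume {ξ : ℝ | t < (1 + |ξ|) ^ (-β) * ‖𝓕 f ξ‖}) ^ (1 / q) ≤
          ENNReal.ofReal (3 ^ (1 / q) * 2) * eLpNorm f (ENNReal.ofReal p) volume := by
    intro h0
    have : {ξ : ℝ | t < (1 + |ξ|) ^ (-β) * ‖𝓕 f ξ‖} = ∅ := by
      ext ξ; simp [h0, ht.le]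
    rw [this, measure_empty, ENNReal.zero_rpow_of_pos (by positivity), mul_zero]
    exact zero_le
  by_cases hf1 : Integrable f volume
  swap
  · -- the Bochner integral is zero by convention
    apply hempty
    intro ξ
    rw [Real.fourier_eq]
    apply integral_undef
    intro hc
    exact hf1 ((VectorFourier.fourierIntegral_convergent_iff (L := innerₗ ℝ)
      Real.continuous_fourierChar continuous_inner ξ).1 hc)
  have hpne : ENNReal.ofReal p ≠ 0 := by simpa using hp0
  by_cases hz : eLpNorm f (ENNReal.ofReal p) volume = 0
  · apply hempty
    intro ξ
    rw [eLpNorm_eq_zero_iff hf.1 hpne] at hz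
    rw [Real.fourier_congr_ae hz]
    simp [Real.fourier_eq]
  set A : ℝ := (eLpNorm f (ENNReal.ofReal p) volume).toReal with hAd
  have hA : 0 < A := ENNReal.toReal_pos hz hf.2.ne
  have hAe : eLpNorm f (ENNReal.ofReal p) volume = ENNReal.ofReal A :=
    (ENNReal.ofReal_toReal hf.2.ne).symm
  -- measurable representative
  obtain ⟨g, hgm, hfg⟩ := hf.1
  have hg1 : Integrable g volume := hf1.congr hfg
  have hgp : MemLp g (ENNReal.ofReal p) volume := hf.ae_eq hfg
  have hFg : ∀ ξ, 𝓕 f ξ = 𝓕 g ξ := fun ξ => Real.fourier_congr_ae hfg ξ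
  have hgi : Integrable (fun x => ‖g x‖ ^ p) volume := by
    have := hgp.integrable_norm_rpow hpne ENNReal.ofReal_ne_top
    rwa [ENNReal.toReal_ofReal hp0.le] at this
  have hgI : ∫ x, ‖g x‖ ^ p = A ^ p := by
    have h0 : 0 ≤ ∫ x, ‖g x‖ ^ p := integral_nonneg fun x => by positivity
    rw [hAd, eLpNorm_congr_ae hfg, hgp.eLpNorm_eq_integral_rpow_norm hpne ENNReal.ofReal_ne_top,
      ENNReal.toReal_ofReal hp0.le, ENNReal.toReal_ofReal (by positivity), ← Real.rpow_mul h0,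
      inv_mul_cancel₀ hp0.ne', Real.rpow_one]
  set R : ℝ := (2 * A / t) ^ q with hRd
  have hR : 0 < R := by positivity
  have hwk := weak_hausdorff_young p hp1 hp2 g hgm hg1 hgi A hA hgI R hR
  have hRq : R ^ (1 / q) = 2 * A / t := by
    rw [hRd, ← Real.rpow_mul (by positivity), mul_one_div_cancel hq.ne', Real.rpow_one]
  set s : ℝ := 1 / q - (1 - 1 / p) with hs
  have hkey : t * R ^ s = 2 * (R ^ (1 / p - 1) * A) := by
    have : R ^ s = R ^ (1 / q) * R ^ (1 / p - 1) := by
      rw [← Real.rpow_add hR]; congr 1; rw [hs]; ring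
    rw [this, hRq]; field_simp
  have hsub : {ξ : ℝ | t < (1 + |ξ|) ^ (-β) * ‖𝓕 f ξ‖} ⊆
      Icc (-R) R ∪ {ξ : ℝ | 2 * (R ^ (1 / p - 1) * A) < ‖𝓕 g ξ‖} := by
    intro ξ hξ
    by_cases hξR : |ξ| ≤ R
    · left; exact abs_le.1 hξR
    right
    push Not at hξR
    simp only [mem_ofPred_eq] at hξ ⊢
    rw [hFg] at hξ
    rw [← hkey]
    have h1 : (1 : ℝ) ≤ 1 + |ξ| := by linarith [abs_nonneg ξ]
    have h2 : (1 + |ξ|) ^ (-β) ≤ (R ^ s)⁻¹ := by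
      calc (1 + |ξ|) ^ (-β) ≤ (1 + |ξ|) ^ (-s) :=
            Real.rpow_le_rpow_of_exponent_le h1 (by linarith)
        _ ≤ R ^ (-s) := Real.rpow_le_rpow_of_nonpos hR (by linarith) (by linarith)
        _ = _ := Real.rpow_neg hR.le s
    have h3 : t < (R ^ s)⁻¹ * ‖𝓕 g ξ‖ :=
      hξ.trans_le (mul_le_mul_of_nonneg_right h2 (norm_nonneg _))
    rw [inv_mul_eq_div, lt_div_iff₀ (by positivity)] at h3
    exact h3
  have hvol : volume {ξ : ℝ | t < (1 + |ξ|) ^ (-β) * ‖𝓕 f ξ‖} ≤ ENNReal.ofReal (3 * R) := by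
    calc _ ≤ _ := measure_mono hsub
      _ ≤ _ := measure_union_le _ _
      _ ≤ ENNReal.ofReal (R - -R) + ENNReal.ofReal R := by
          rw [Real.volume_Icc]; gcongr
      _ = ENNReal.ofReal (3 * R) := by
          rw [← ENNReal.ofReal_add (by linarith) hR.le]; congr 1; ring
  calc ENNReal.ofReal t * (volume {ξ : ℝ | t < (1 + |ξ|) ^ (-β) * ‖𝓕 f ξ‖}) ^ (1 / q)
      ≤ ENNReal.ofReal t * (ENNReal.ofReal (3 * R)) ^ (1 / q) := by gcongr
    _ = ENNReal.ofReal (3 ^ (1 / q) * 2) * eLpNorm f (ENNReal.ofReal p) volume := by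
        rw [hAe, ENNReal.ofReal_rpow_of_pos (by positivity), ← ENNReal.ofReal_mul ht.le,
          ← ENNReal.ofReal_mul (by positivity), Real.mul_rpow (by norm_num) hR.le, hRq]
        congr 1
        field_simp
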